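/- Fix R > 0 and define vector fields k, g₊, g₋ : ℝ² → ℝ² by k(x,y) = ((R² − x²)/(2R), −(R² − y²)/(2R)), g₊(x,y) = ((x − R)²/(2R), −(y + R)²/(2R)), and g₋(x,y) = (−(x + R)²/(2R), (y − R)²/(2R)). Then their Lie brackets satisfy ⁅g₋, g₊⁆ = 2 • k, ⁅g₊, k⁆ = g₊, and ⁅g₋, k⁆ = −g₋. -/

import Mathlib

/-- The Lie bracket of vector fields `V W : ℝ² → ℝ²`:
`⁅V, W⁆(x) = DW(x)·V(x) − DV(x)·W(x)`. -/
noncomputable def lieBracketVF (V W : ℝ × ℝ → ℝ × ℝ) : ℝ × ℝ → ℝ × ℝ :=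
  fun x => fderiv ℝ W x (V x) - fderiv ℝ V x (W x)

/-- The Lie bracket of split vector fields `(a(x), b(y))` and `(c(x), d(y))` is computed
componentwise by the one-dimensional bracket. -/
lemma lieBracketVF_prodMap_apply {a b c d : ℝ → ℝ} {a' b' c' d' x y : ℝ}
    (ha : HasDerivAt a a' x) (hb : HasDerivAt b b' y)
    (hc : HasDerivAt c c' x) (hd : HasDerivAt d d' y) :
    lieBracketVF (Prod.map a b) (Prod.map c d) (x, y) =
      (c' * a x - a' * c x, d' * b y - b' * d y) := by
  have hab := HasFDerivAt.prodMap (x, y) ha.hasFDerivAt hb.hasFDerivAt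
  have hcd := HasFDerivAt.prodMap (x, y) hc.hasFDerivAt hd.hasFDerivAt
  rw [lieBracketVF, hab.fderiv, hcd.fderiv]
  simp [mul_comm]

lemma hasDerivAt_add_const_sq_div (s r x : ℝ) :
    HasDerivAt (fun t => (t + s) ^ 2 / r) (2 * (x + s) / r) x := by
  simpa using (((hasDerivAt_id x).add_const s).pow 2).div_const r

lemma hasDerivAt_sub_const_sq_div (s r x : ℝ) :
    HasDerivAt (fun t => (t - s) ^ 2 / r) (2 * (x - s) / r) x := by
  simpa using (((hasDerivAt_id x).sub_const s).pow 2).div_const r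

lemma hasDerivAt_const_sub_sq_div (s r x : ℝ) :
    HasDerivAt (fun t => (s - t ^ 2) / r) (-(2 * x) / r) x := by
  simpa using (((hasDerivAt_id x).pow 2).const_sub s).div_const r

/-- The modular generator `k` and modular scrambling modes `g₊, g₋` of a causal
diamond of radius `R` in a 1+1-dimensional CFT satisfy the `sl(2,ℝ)` relations
`⁅g₋, g₊⁆ = 2 k`, `⁅g₊, k⁆ = g₊` and `⁅g₋, k⁆ = −g₋`. -/
theorem causal_diamond_scrambling_mode_brackets (R : ℝ) (hR : 0 < R)
    (k gp gm : ℝ × ℝ → ℝ × ℝ)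
    (hk : ∀ x y : ℝ, k (x, y) = ((R ^ 2 - x ^ 2) / (2 * R), -((R ^ 2 - y ^ 2) / (2 * R))))
    (hgp : ∀ x y : ℝ, gp (x, y) = ((x - R) ^ 2 / (2 * R), -((y + R) ^ 2 / (2 * R))))
    (hgm : ∀ x y : ℝ, gm (x, y) = (-((x + R) ^ 2 / (2 * R)), (y - R) ^ 2 / (2 * R))) :
    lieBracketVF gm gp = (2 : ℝ) • k ∧
    lieBracketVF gp k = gp ∧
    lieBracketVF gm k = -gm := by
  obtain rfl : k = Prod.map (fun x => (R ^ 2 - x ^ 2) / (2 * R))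
      (fun y => -((R ^ 2 - y ^ 2) / (2 * R))) := funext fun p => hk p.1 p.2
  obtain rfl : gp = Prod.map (fun x => (x - R) ^ 2 / (2 * R))
      (fun y => -((y + R) ^ 2 / (2 * R))) := funext fun p => hgp p.1 p.2
  obtain rfl : gm = Prod.map (fun x => -((x + R) ^ 2 / (2 * R)))
      (fun y => (y - R) ^ 2 / (2 * R)) := funext fun p => hgm p.1 p.2
  have hadd := hasDerivAt_add_const_sq_div R (2 * R)
  have hsub := hasDerivAt_sub_const_sq_div R (2 * R)
  have hsq := hasDerivAt_const_sub_sq_div (R ^ 2) (2 * R)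
  refine ⟨?_, ?_, ?_⟩ <;> funext ⟨x, y⟩
  · rw [lieBracketVF_prodMap_apply (hadd x).fun_neg (hsub y) (hsub x) (hadd y).fun_neg]
    ext <;> simp <;> field_simp <;> ring
  · rw [lieBracketVF_prodMap_apply (hsub x) (hadd y).fun_neg (hsq x) (hsq y).fun_neg]
    ext <;> simp <;> field_simp <;> ring
  · rw [lieBracketVF_prodMap_apply (hadd x).fun_neg (hsub y) (hsq x) (hsq y).fun_neg]
    ext <;> simp <;> field_simp <;> ring
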